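/- Let P(x,y,D_x,D_y) = Σ_{|α+β+γ+μ|≤m} c_{αβγμ} x^α y^β D_x^γ D_y^μ be a linear partial differential operator with polynomial coefficients on ℝ^{2N} (c_{αβγμ} ∈ ℂ, α,β,γ,μ ∈ ℕ_0^N). Then for every Schwartz function u on ℝ^{2N}: P(M_f, M_s, D_f, D_s) Wig[u] = Wig[ P̄ u ], where P̄ = Σ_{|α+β+γ+μ|≤m} c_{αβγμ} ((M_s+M_f)/2)^α ((D_f−D_s)/2)^β (D_f+D_s)^γ (M_s−M_f)^μ, the composition being applied from right to left in the order written. -/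

import Mathlib

open MeasureTheory Filter
open scoped ENNReal NNReal

noncomputable section

/-- Euclidean pairing `x·ξ = ∑ x_j ξ_j`. -/
def dotR {M : ℕ} (x ξ : Fin M → ℝ) : ℝ := ∑ j, x j * ξ j

/-- Fourier transform with kernel `e^{-i x·ξ}`. -/
def FT {M : ℕ} (f : (Fin M → ℝ) → ℂ) (ξ : Fin M → ℝ) : ℂ :=
  ∫ x, Complex.exp (-(Complex.I * (dotR x ξ : ℂ))) * f x

/-- sup-norm (in `ℝ≥0∞`) of a complex-valued function. -/
def supNorm {M : ℕ} (f : (Fin M → ℝ) → ℂ) : ℝ≥0∞ := ⨆ x, (‖f x‖₊ : ℝ≥0∞)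

/-- partial derivative `∂_j`. -/
def pD {M : ℕ} (j : Fin M) (f : (Fin M → ℝ) → ℂ) : (Fin M → ℝ) → ℂ :=
  fun x => fderiv ℝ f x (Pi.single j 1)

/-- iterated partial derivative `∂^α`. -/
def pDpow {M : ℕ} (α : Fin M → ℕ) (f : (Fin M → ℝ) → ℂ) : (Fin M → ℝ) → ℂ :=
  ((List.ofFn fun j : Fin M => (pD j)^[α j]).foldr (· ∘ ·) id) f

/-- `D^α = (-i)^{|α|} ∂^α`. -/
def Dpow {M : ℕ} (α : Fin M → ℕ) (f : (Fin M → ℝ) → ℂ) : (Fin M → ℝ) → ℂ :=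
  fun x => (-Complex.I) ^ (∑ j, α j) * pDpow α f x

/-- multiplication by the monomial `x^α`. -/
def monMul {M : ℕ} (α : Fin M → ℕ) (f : (Fin M → ℝ) → ℂ) : (Fin M → ℝ) → ℂ :=
  fun x => ((∏ j, (x j) ^ (α j) : ℝ) : ℂ) * f x

/-- Weight function in the sense of the paper (extended to `ℝ` by `ω x = ω |x|`):
continuous, increasing on `[0,∞)`, nonnegative, together with conditions
(α), (β), (γ), (δ). -/
structure IsWeightFun (ω : ℝ → ℝ) : Prop where
  nonneg : ∀ x, 0 ≤ ω x
  eq_abs : ∀ x, ω x = ω |x|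
  continuous : Continuous ω
  mono : MonotoneOn ω (Set.Ici 0)
  alphaCond : ∃ K, 1 ≤ K ∧ ∀ x, 0 ≤ x → ω (2 * x) ≤ K * (1 + ω x)
  betaCond : Filter.Tendsto (fun x => ω x / x) Filter.atTop (nhds 0)
  gammaCond : ∃ a b : ℝ, 0 < b ∧ ∀ x, 0 ≤ x → a + b * Real.log (1 + x) ≤ ω x
  deltaCond : ConvexOn ℝ (Set.Ici 0) fun t => ω (Real.exp t)

/-- non-isotropic weight `Ω(x) = ω_1(x_1) + ⋯ + ω_M(x_M)`. -/
def wSum {M : ℕ} (ω : Fin M → ℝ → ℝ) (x : Fin M → ℝ) : ℝ := ∑ j, ω j (x j)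

/-- Membership in the space `S_Ω^Σ(ℝ^M)`: `f ∈ L¹`, `f` and `f̂` smooth, and for
every `λ > 0` and every multi-index `α`, `‖e^{λΩ} D^α f‖_∞ < ∞` and
`‖e^{λΣ} D^α f̂‖_∞ < ∞`. -/
structure MemS {M : ℕ} (Om Sig : (Fin M → ℝ) → ℝ) (f : (Fin M → ℝ) → ℂ) : Prop where
  integrable : Integrable f
  smooth : ContDiff ℝ (⊤ : ℕ∞) f
  smooth_ft : ContDiff ℝ (⊤ : ℕ∞) (FT f)
  decay : ∀ lam : ℝ, 0 < lam → ∀ α : Fin M → ℕ,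
      supNorm (fun x => (Real.exp (lam * Om x) : ℂ) * Dpow α f x) < ⊤
  decay_ft : ∀ lam : ℝ, 0 < lam → ∀ α : Fin M → ℕ,
      supNorm (fun ξ => (Real.exp (lam * Sig ξ) : ℂ) * Dpow α (FT f) ξ) < ⊤

/-- first block of variables of `z ∈ ℝ^{2N}`. -/
def firstB {N : ℕ} (z : Fin (N + N) → ℝ) : Fin N → ℝ := fun j => z (Fin.castAdd N j)

/-- second block of variables of `z ∈ ℝ^{2N}`. -/
def secondB {N : ℕ} (z : Fin (N + N) → ℝ) : Fin N → ℝ := fun j => z (Fin.natAdd N j)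

/-- the Wigner-type transform
`Wig[u](x,ξ) = ∫ e^{-i t·ξ} u(x + t/2, x - t/2) dt`. -/
def Wig {N : ℕ} (u : (Fin (N + N) → ℝ) → ℂ) (z : Fin (N + N) → ℝ) : ℂ :=
  ∫ t : Fin N → ℝ, Complex.exp (-(Complex.I * (dotR t (secondB z) : ℂ))) *
    u (Fin.append (fun j => firstB z j + t j / 2) (fun j => firstB z j - t j / 2))

/-- operators acting on functions on `ℝ^M`. -/
abbrev OpC (M : ℕ) := ((Fin M → ℝ) → ℂ) → ((Fin M → ℝ) → ℂ)

/-- multiplication by the coordinate `x_j`. -/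
def mulC {M : ℕ} (j : Fin M) : OpC M := fun f x => (x j : ℂ) * f x

/-- the operator `D_j = -i ∂_j`. -/
def Dc {M : ℕ} (j : Fin M) : OpC M := fun f x => -Complex.I * pD j f x

/-- power `R^α = R_1^{α_1} ∘ ⋯ ∘ R_N^{α_N}` of a vector of (pairwise commuting)
operators. -/
def vecPow {M N : ℕ} (R : Fin N → OpC M) (α : Fin N → ℕ) : OpC M :=
  fun f => ((List.ofFn fun j : Fin N => (R j)^[α j]).foldr (· ∘ ·) id) f

/-- The function underlies a Schwartz function. -/
def IsSchwartz {M : ℕ} (f : (Fin M → ℝ) → ℂ) : Prop :=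
  ∃ s : SchwartzMap (Fin M → ℝ) ℂ, ⇑s = f

namespace IsSchwartz

variable {M : ℕ} {f g : (Fin M → ℝ) → ℂ}

theorem add (hf : IsSchwartz f) (hg : IsSchwartz g) : IsSchwartz (f + g) := by
  obtain ⟨s, rfl⟩ := hf
  obtain ⟨t, rfl⟩ := hg
  exact ⟨s + t, rfl⟩

theorem sub (hf : IsSchwartz f) (hg : IsSchwartz g) : IsSchwartz (f - g) := by
  obtain ⟨s, rfl⟩ := hf
  obtain ⟨t, rfl⟩ := hg
  exact ⟨s - t, rfl⟩

theorem smul (c : ℂ) (hf : IsSchwartz f) : IsSchwartz (c • f) := by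
  obtain ⟨s, rfl⟩ := hf
  exact ⟨c • s, rfl⟩

theorem mulC (j : Fin M) (hf : IsSchwartz f) : IsSchwartz (mulC j f) := by
  obtain ⟨s, rfl⟩ := hf
  have hg : Function.HasTemperateGrowth (fun x : Fin M → ℝ => (x j : ℂ)) :=
    (Complex.ofRealCLM.comp
      (ContinuousLinearMap.proj (R := ℝ) (φ := fun _ : Fin M => ℝ) j)).hasTemperateGrowth
  exact ⟨SchwartzMap.smulLeftCLM ℂ (fun x : Fin M → ℝ => (x j : ℂ)) s,
    SchwartzMap.smulLeftCLM_apply hg s⟩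

theorem pD (j : Fin M) (hf : IsSchwartz f) : IsSchwartz (pD j f) := by
  obtain ⟨s, rfl⟩ := hf
  exact ⟨LineDeriv.lineDerivOp (Pi.single j 1 : Fin M → ℝ) s,
    funext fun x => SchwartzMap.lineDerivOp_apply_eq_fderiv _ _ _⟩

theorem Dc (j : Fin M) (hf : IsSchwartz f) : IsSchwartz (Dc j f) :=
  (hf.pD j).smul (-Complex.I)

end IsSchwartz

section VecPow

variable {M N : ℕ}

theorem vecPow_zero (R : Fin 0 → OpC M) (α : Fin 0 → ℕ) (f : (Fin M → ℝ) → ℂ) :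
    vecPow R α f = f := by
  simp [vecPow]

theorem vecPow_succ (R : Fin (N + 1) → OpC M) (α : Fin (N + 1) → ℕ) (f : (Fin M → ℝ) → ℂ) :
    vecPow R α f =
      (R 0)^[α 0] (vecPow (fun j => R j.succ) (fun j => α j.succ) f) := by
  simp [vecPow, List.ofFn_succ]

theorem foldr_comp_eq {X : Type*} (l : List (X → X)) (g : X → X) :
    l.foldr (· ∘ ·) g = l.foldr (· ∘ ·) id ∘ g := by
  induction l with
  | nil => rfl
  | cons a l ih => simp only [List.foldr_cons, ih]; rfl

theorem vecPow_append {K : ℕ} (R : Fin (N + K) → OpC M) (γ : Fin N → ℕ) (μ : Fin K → ℕ)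
    (f : (Fin M → ℝ) → ℂ) :
    vecPow R (Fin.append γ μ) f =
      vecPow (fun j => R (Fin.castAdd K j)) γ (vecPow (fun j => R (Fin.natAdd N j)) μ f) := by
  have h : (List.ofFn fun j => (R j)^[Fin.append γ μ j]) =
      (List.ofFn fun j => (R (Fin.castAdd K j))^[γ j]) ++
        List.ofFn fun j => (R (Fin.natAdd N j))^[μ j] := by
    rw [← List.ofFn_fin_append]
    congr 1
    funext j
    refine Fin.addCases (fun i => ?_) (fun i => ?_) j <;> simp
  simp only [vecPow]
  rw [h, List.foldr_append, foldr_comp_eq]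
  rfl

theorem iterate_intertwine {K : ℕ} {W : ((Fin M → ℝ) → ℂ) → ((Fin K → ℝ) → ℂ)}
    {A : OpC K} {B : OpC M}
    (hB : ∀ f, IsSchwartz f → IsSchwartz (B f))
    (h : ∀ f, IsSchwartz f → A (W f) = W (B f)) (n : ℕ) {f : (Fin M → ℝ) → ℂ}
    (hf : IsSchwartz f) : IsSchwartz (B^[n] f) ∧ A^[n] (W f) = W (B^[n] f) := by
  induction n with
  | zero => exact ⟨hf, rfl⟩
  | succ n ih =>
    rw [Function.iterate_succ_apply', Function.iterate_succ_apply', ih.2, h _ ih.1]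
    exact ⟨hB _ ih.1, rfl⟩

theorem vecPow_intertwine {K : ℕ} {W : ((Fin M → ℝ) → ℂ) → ((Fin K → ℝ) → ℂ)}
    {A : Fin N → OpC K} {B : Fin N → OpC M}
    (hB : ∀ j f, IsSchwartz f → IsSchwartz (B j f))
    (h : ∀ j f, IsSchwartz f → A j (W f) = W (B j f)) (α : Fin N → ℕ)
    {f : (Fin M → ℝ) → ℂ} (hf : IsSchwartz f) :
    IsSchwartz (vecPow B α f) ∧ vecPow A α (W f) = W (vecPow B α f) := by
  induction N with
  | zero => simpa only [vecPow_zero, and_true] using hf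
  | succ n ih =>
    have ih' := ih (A := fun j => A j.succ) (B := fun j => B j.succ)
      (fun j => hB j.succ) (fun j => h j.succ) (fun j => α j.succ)
    rw [vecPow_succ, vecPow_succ, ih'.2]
    exact iterate_intertwine (hB 0) (h 0) _ ih'.1

theorem mulC_iterate (j : Fin M) (n : ℕ) (f : (Fin M → ℝ) → ℂ) (x : Fin M → ℝ) :
    (mulC j)^[n] f x = (x j : ℂ) ^ n * f x := by
  induction n with
  | zero => simp
  | succ n ih =>
    rw [Function.iterate_succ_apply', mulC, ih]
    ring

theorem vecPow_mulC (σ : Fin N → Fin M) (α : Fin N → ℕ) (f : (Fin M → ℝ) → ℂ)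
    (x : Fin M → ℝ) :
    vecPow (fun j => mulC (σ j)) α f x = ((∏ j, x (σ j) ^ α j : ℝ) : ℂ) * f x := by
  induction N with
  | zero => simp [vecPow_zero]
  | succ n ih =>
    rw [vecPow_succ, mulC_iterate, ih (fun j => σ j.succ), Fin.prod_univ_succ]
    push_cast
    ring

theorem pD_const_smul (j : Fin M) (c : ℂ) (f : (Fin M → ℝ) → ℂ) :
    pD j (c • f) = c • pD j f := by
  funext x
  simp only [pD, Pi.smul_apply]
  rw [fderiv_const_smul_field]
  rfl

theorem Dc_iterate_const_smul (j : Fin M) (n : ℕ) (c : ℂ) (f : (Fin M → ℝ) → ℂ) :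
    (Dc j)^[n] (c • f) = ((-Complex.I) ^ n * c) • (pD j)^[n] f := by
  induction n with
  | zero => simp
  | succ n ih =>
    rw [Function.iterate_succ_apply', Function.iterate_succ_apply', ih]
    change (-Complex.I) • pD j _ = _
    rw [pD_const_smul, smul_smul, pow_succ']
    ring_nf

theorem vecPow_Dc (σ : Fin N → Fin M) (α : Fin N → ℕ) (f : (Fin M → ℝ) → ℂ) :
    vecPow (fun j => Dc (σ j)) α f =
      (-Complex.I) ^ (∑ j, α j) • vecPow (fun j => pD (σ j)) α f := by
  induction N with
  | zero => simp [vecPow_zero]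
  | succ n ih =>
    rw [vecPow_succ, ih (fun j => σ j.succ), Dc_iterate_const_smul, ← pow_add,
      ← Fin.sum_univ_succ, vecPow_succ]

theorem Dpow_eq_vecPow (α : Fin M → ℕ) (f : (Fin M → ℝ) → ℂ) : Dpow α f = vecPow Dc α f :=
  (vecPow_Dc (fun j => j) α f).symm

end VecPow

section Wigner

variable {N : ℕ}

/-- The linear map `z = (x, ξ) ↦ (x, x)`. -/
def diagCLM (N : ℕ) : (Fin (N + N) → ℝ) →L[ℝ] (Fin (N + N) → ℝ) :=
  ContinuousLinearMap.pi
    (Fin.append (fun j => ContinuousLinearMap.proj (R := ℝ) (Fin.castAdd N j))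
      (fun j => ContinuousLinearMap.proj (R := ℝ) (Fin.castAdd N j)))

/-- The linear map `t ↦ (t/2, -t/2)`. -/
def antidiagCLM (N : ℕ) : (Fin N → ℝ) →L[ℝ] (Fin (N + N) → ℝ) :=
  ContinuousLinearMap.pi
    (Fin.append (fun j => (2⁻¹ : ℝ) • ContinuousLinearMap.proj (R := ℝ) j)
      (fun j => (-2⁻¹ : ℝ) • ContinuousLinearMap.proj (R := ℝ) j))

/-- The bilinear pairing `(t, z = (x, ξ)) ↦ t · ξ`. -/
def phaseCLM (N : ℕ) : (Fin N → ℝ) →L[ℝ] (Fin (N + N) → ℝ) →L[ℝ] ℝ :=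
  ∑ j, (ContinuousLinearMap.proj (R := ℝ) j).smulRight
    (ContinuousLinearMap.proj (R := ℝ) (φ := fun _ : Fin (N + N) => ℝ) (Fin.natAdd N j))

@[simp] theorem diagCLM_castAdd (z : Fin (N + N) → ℝ) (j : Fin N) :
    diagCLM N z (Fin.castAdd N j) = z (Fin.castAdd N j) := by
  simp [diagCLM, -Fin.natAdd_eq_addNat]

@[simp] theorem diagCLM_natAdd (z : Fin (N + N) → ℝ) (j : Fin N) :
    diagCLM N z (Fin.natAdd N j) = z (Fin.castAdd N j) := by
  simp [diagCLM, -Fin.natAdd_eq_addNat]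

@[simp] theorem antidiagCLM_castAdd (t : Fin N → ℝ) (j : Fin N) :
    antidiagCLM N t (Fin.castAdd N j) = t j / 2 := by
  simp [antidiagCLM, -Fin.natAdd_eq_addNat]
  ring

@[simp] theorem antidiagCLM_natAdd (t : Fin N → ℝ) (j : Fin N) :
    antidiagCLM N t (Fin.natAdd N j) = -(t j / 2) := by
  simp [antidiagCLM, -Fin.natAdd_eq_addNat]
  ring

theorem phaseCLM_apply (t : Fin N → ℝ) (z : Fin (N + N) → ℝ) :
    phaseCLM N t z = dotR t (secondB z) := by
  simp [phaseCLM, dotR, secondB]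

theorem funext_blocks {X : Type*} {f g : Fin (N + N) → X}
    (h₁ : ∀ j : Fin N, f (Fin.castAdd N j) = g (Fin.castAdd N j))
    (h₂ : ∀ j : Fin N, f (Fin.natAdd N j) = g (Fin.natAdd N j)) : f = g :=
  funext fun i => Fin.addCases h₁ h₂ i

theorem append_eq_diagCLM_add_antidiagCLM (z : Fin (N + N) → ℝ) (t : Fin N → ℝ) :
    Fin.append (fun j => firstB z j + t j / 2) (fun j => firstB z j - t j / 2) =
      diagCLM N z + antidiagCLM N t := by
  apply funext_blocks <;> intro j <;> simp [firstB, sub_eq_add_neg, -Fin.natAdd_eq_addNat]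

/-- The oscillating factor `e^{-i t·ξ}`. -/
def osc (z : Fin (N + N) → ℝ) (t : Fin N → ℝ) : ℂ :=
  Complex.exp (-(Complex.I * (phaseCLM N t z : ℂ)))

theorem Wig_apply (u : (Fin (N + N) → ℝ) → ℂ) (z : Fin (N + N) → ℝ) :
    Wig u z = ∫ t, osc z t * u (diagCLM N z + antidiagCLM N t) := by
  simp only [Wig, osc, phaseCLM_apply, append_eq_diagCLM_add_antidiagCLM]

theorem norm_osc (z : Fin (N + N) → ℝ) (t : Fin N → ℝ) : ‖osc z t‖ = 1 := by
  rw [osc, Complex.norm_exp]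
  simp

theorem continuous_osc (z : Fin (N + N) → ℝ) : Continuous (osc z) := by
  have : Continuous fun t => phaseCLM N t z := ((phaseCLM N).flip z).continuous
  unfold osc
  fun_prop

theorem hasFDerivAt_osc_left (z : Fin (N + N) → ℝ) (t : Fin N → ℝ) :
    HasFDerivAt (fun z => osc z t)
      (osc z t • -(Complex.I • Complex.ofRealCLM.comp (phaseCLM N t))) z :=
  ((((Complex.ofRealCLM.comp (phaseCLM N t)).hasFDerivAt (x := z)).const_mul
    Complex.I).fun_neg).cexp

theorem hasFDerivAt_osc_right (z : Fin (N + N) → ℝ) (t : Fin N → ℝ) :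
    HasFDerivAt (osc z)
      (osc z t • -(Complex.I • Complex.ofRealCLM.comp ((phaseCLM N).flip z))) t :=
  ((((Complex.ofRealCLM.comp ((phaseCLM N).flip z)).hasFDerivAt (x := t)).const_mul
    Complex.I).fun_neg).cexp

theorem norm_le_two_mul_norm_point (z : Fin (N + N) → ℝ) (t : Fin N → ℝ) :
    ‖t‖ ≤ 2 * ‖diagCLM N z + antidiagCLM N t‖ := by
  refine (pi_norm_le_iff_of_nonneg (by positivity)).2 fun j => ?_
  have h₁ := norm_le_pi_norm (diagCLM N z + antidiagCLM N t) (Fin.castAdd N j)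
  have h₂ := norm_le_pi_norm (diagCLM N z + antidiagCLM N t) (Fin.natAdd N j)
  have h : t j = (diagCLM N z + antidiagCLM N t) (Fin.castAdd N j) -
      (diagCLM N z + antidiagCLM N t) (Fin.natAdd N j) := by
    simp [-Fin.natAdd_eq_addNat]
  rw [h]
  exact (norm_sub_le _ _).trans (by linarith)

theorem exists_decay {F : Type*} [NormedAddCommGroup F] [NormedSpace ℝ F]
    (s : SchwartzMap (Fin (N + N) → ℝ) F) (k : ℕ) :
    ∃ C : ℝ, ∀ z t, (1 + ‖t‖) ^ k * ‖s (diagCLM N z + antidiagCLM N t)‖ ≤ C := by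
  refine ⟨2 ^ k * (2 ^ k * (Finset.Iic (k, 0)).sup
    (fun m => SchwartzMap.seminorm ℝ m.1 m.2) s), fun z t => ?_⟩
  have h := SchwartzMap.one_add_le_sup_seminorm_apply (𝕜 := ℝ) (m := (k, 0)) le_rfl le_rfl s
    (diagCLM N z + antidiagCLM N t)
  rw [norm_iteratedFDeriv_zero] at h
  calc (1 + ‖t‖) ^ k * ‖s (diagCLM N z + antidiagCLM N t)‖
      ≤ (2 * (1 + ‖diagCLM N z + antidiagCLM N t‖)) ^ k *
          ‖s (diagCLM N z + antidiagCLM N t)‖ := by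
        gcongr
        linarith [norm_le_two_mul_norm_point z t]
    _ = 2 ^ k * ((1 + ‖diagCLM N z + antidiagCLM N t‖) ^ k *
          ‖s (diagCLM N z + antidiagCLM N t)‖) := by rw [mul_pow, mul_assoc]
    _ ≤ _ := by gcongr

theorem integrable_inv_one_add_norm_pow (N : ℕ) :
    Integrable fun t : Fin N → ℝ => ((1 + ‖t‖) ^ (N + 1))⁻¹ := by
  have h := integrable_one_add_norm (E := Fin N → ℝ) (μ := volume) (r := ((N + 1 : ℕ) : ℝ))
    (by simp)
  refine h.congr (Eventually.of_forall fun t => ?_)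
  simp only
  rw [Real.rpow_neg (by positivity), Real.rpow_natCast]

theorem integrable_osc_mul {f : (Fin (N + N) → ℝ) → ℂ} (hf : IsSchwartz f)
    (z : Fin (N + N) → ℝ) :
    Integrable fun t => osc z t * f (diagCLM N z + antidiagCLM N t) := by
  obtain ⟨s, rfl⟩ := hf
  obtain ⟨C, hC⟩ := exists_decay s (N + 1)
  refine ((integrable_inv_one_add_norm_pow N).const_mul C).mono' ?_
    (Eventually.of_forall fun t => ?_)
  · have := continuous_osc z
    exact Continuous.aestronglyMeasurable (by fun_prop)
  · rw [norm_mul, norm_osc, one_mul, ← div_eq_mul_inv, le_div_iff₀' (by positivity)]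
    exact hC z t

theorem pD_Wig (s : SchwartzMap (Fin (N + N) → ℝ) ℂ) (i : Fin (N + N))
    (z : Fin (N + N) → ℝ) :
    pD i (Wig ⇑s) z = ∫ t, osc z t *
      (fderiv ℝ s (diagCLM N z + antidiagCLM N t) (diagCLM N (Pi.single i 1)) -
        Complex.I * phaseCLM N t (Pi.single i 1) * s (diagCLM N z + antidiagCLM N t)) := by
  let s' := SchwartzMap.fderivCLM ℝ (Fin (N + N) → ℝ) ℂ s
  let F' : (Fin (N + N) → ℝ) → (Fin N → ℝ) → (Fin (N + N) → ℝ) →L[ℝ] ℂ := fun z t =>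
    osc z t • (s' (diagCLM N z + antidiagCLM N t)).comp (diagCLM N) +
      s (diagCLM N z + antidiagCLM N t) •
        (osc z t • -(Complex.I • Complex.ofRealCLM.comp (phaseCLM N t)))
  obtain ⟨C₀, hC₀⟩ := exists_decay s (N + 2)
  obtain ⟨C₁, hC₁⟩ := exists_decay s' (N + 1)
  let bound : (Fin N → ℝ) → ℝ := fun t =>
    (C₁ * ‖diagCLM N‖ + C₀ * ‖phaseCLM N‖) * ((1 + ‖t‖) ^ (N + 1))⁻¹
  have hbound : ∀ z t, ‖F' z t‖ ≤ bound t := by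
    intro z t
    have h₁ : ‖s' (diagCLM N z + antidiagCLM N t)‖ ≤ C₁ * ((1 + ‖t‖) ^ (N + 1))⁻¹ := by
      rw [← div_eq_mul_inv, le_div_iff₀' (by positivity)]
      exact hC₁ z t
    have h₀ : ‖t‖ * ‖s (diagCLM N z + antidiagCLM N t)‖ ≤ C₀ * ((1 + ‖t‖) ^ (N + 1))⁻¹ := by
      rw [← div_eq_mul_inv, le_div_iff₀' (by positivity)]
      refine le_trans ?_ (hC₀ z t)
      rw [pow_succ _ (N + 1), mul_assoc]
      gcongr
      linarith
    have h₂ : ‖Complex.ofRealCLM.comp (phaseCLM N t)‖ ≤ ‖phaseCLM N‖ * ‖t‖ := by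
      refine (ContinuousLinearMap.opNorm_comp_le _ _).trans ?_
      rw [Complex.ofRealCLM_norm, one_mul]
      exact (phaseCLM N).le_opNorm t
    calc ‖F' z t‖
        ≤ ‖s' (diagCLM N z + antidiagCLM N t)‖ * ‖diagCLM N‖ +
          ‖s (diagCLM N z + antidiagCLM N t)‖ * (‖phaseCLM N‖ * ‖t‖) := by
          refine (norm_add_le _ _).trans (add_le_add ?_ ?_)
          · rw [norm_smul, norm_osc, one_mul]
            exact ContinuousLinearMap.opNorm_comp_le _ _
          · rw [norm_smul, norm_smul, norm_osc, one_mul, norm_neg, norm_smul, Complex.norm_I,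
              one_mul]
            gcongr
      _ = ‖s' (diagCLM N z + antidiagCLM N t)‖ * ‖diagCLM N‖ +
          (‖t‖ * ‖s (diagCLM N z + antidiagCLM N t)‖) * ‖phaseCLM N‖ := by ring
      _ ≤ C₁ * ((1 + ‖t‖) ^ (N + 1))⁻¹ * ‖diagCLM N‖ +
          C₀ * ((1 + ‖t‖) ^ (N + 1))⁻¹ * ‖phaseCLM N‖ := by gcongr
      _ = bound t := by simp only [bound]; ring
  have hbound_int : Integrable bound := (integrable_inv_one_add_norm_pow N).const_mul _
  have hF'_meas : AEStronglyMeasurable (F' z) := by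
    have h := continuous_osc z
    have hs : Continuous fun t => s' (diagCLM N z + antidiagCLM N t) := by fun_prop
    have hs₀ : Continuous fun t => s (diagCLM N z + antidiagCLM N t) := by fun_prop
    have hφ : Continuous fun t => Complex.ofRealCLM.comp (phaseCLM N t) :=
      continuous_const.clm_comp (phaseCLM N).continuous
    exact ((h.smul (hs.clm_comp continuous_const)).add
      (hs₀.smul (h.smul (hφ.const_smul Complex.I).neg))).aestronglyMeasurable
  have hderiv : HasFDerivAt (Wig ⇑s) (∫ t, F' z t) z := by
    rw [show Wig ⇑s = _ from funext (Wig_apply ⇑s)]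
    refine hasFDerivAt_integral_of_dominated_of_fderiv_le (F' := F') (bound := bound)
      Filter.univ_mem (Eventually.of_forall fun w => (integrable_osc_mul ⟨s, rfl⟩ w).1)
      (integrable_osc_mul ⟨s, rfl⟩ z) hF'_meas
      (Eventually.of_forall fun t w _ => hbound w t) hbound_int
      (Eventually.of_forall fun t w _ => ?_)
    exact (hasFDerivAt_osc_left w t).mul ((s.hasFDerivAt _).comp w
      ((diagCLM N).hasFDerivAt.add_const _))
  have hF'_int : Integrable (F' z) :=
    hbound_int.mono' hF'_meas (Eventually.of_forall (hbound z))
  rw [pD, hderiv.fderiv, ContinuousLinearMap.integral_apply hF'_int]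
  refine integral_congr_ae (Eventually.of_forall fun t => ?_)
  simp [F', s', SchwartzMap.fderivCLM_apply]
  ring

theorem single_castAdd_castAdd (i j : Fin N) :
    (Pi.single (Fin.castAdd N j) 1 : Fin (N + N) → ℝ) (Fin.castAdd N i) =
      (Pi.single j 1 : Fin N → ℝ) i := by
  simp [Pi.single_apply]

theorem single_natAdd_natAdd (i j : Fin N) :
    (Pi.single (Fin.natAdd N j) 1 : Fin (N + N) → ℝ) (Fin.natAdd N i) =
      (Pi.single j 1 : Fin N → ℝ) i := by
  simp [Pi.single_apply, -Fin.natAdd_eq_addNat]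

theorem single_castAdd_natAdd (i j : Fin N) :
    (Pi.single (Fin.castAdd N j) 1 : Fin (N + N) → ℝ) (Fin.natAdd N i) = 0 := by
  refine Pi.single_eq_of_ne (fun h => ?_) _
  have := congrArg Fin.val h
  simp only [Fin.val_natAdd, Fin.val_castAdd] at this
  omega

theorem single_natAdd_castAdd (i j : Fin N) :
    (Pi.single (Fin.natAdd N j) 1 : Fin (N + N) → ℝ) (Fin.castAdd N i) = 0 := by
  refine Pi.single_eq_of_ne (fun h => ?_) _
  have := congrArg Fin.val h
  simp only [Fin.val_natAdd, Fin.val_castAdd] at this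
  omega

theorem diagCLM_single_castAdd (j : Fin N) :
    diagCLM N (Pi.single (Fin.castAdd N j) 1) =
      Pi.single (Fin.castAdd N j) 1 + Pi.single (Fin.natAdd N j) 1 := by
  apply funext_blocks <;> intro i <;>
    simp only [diagCLM_castAdd, diagCLM_natAdd, Pi.add_apply, single_castAdd_castAdd,
      single_castAdd_natAdd, single_natAdd_castAdd, single_natAdd_natAdd, add_zero, zero_add]

theorem diagCLM_single_natAdd (j : Fin N) :
    diagCLM N (Pi.single (Fin.natAdd N j) 1) = 0 := by
  apply funext_blocks <;> intro i <;>
    simp only [diagCLM_castAdd, diagCLM_natAdd, single_natAdd_castAdd, Pi.zero_apply]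

theorem antidiagCLM_single (j : Fin N) :
    antidiagCLM N (Pi.single j 1) =
      (2⁻¹ : ℝ) • (Pi.single (Fin.castAdd N j) 1 - Pi.single (Fin.natAdd N j) 1) := by
  apply funext_blocks <;> intro i <;>
    simp only [antidiagCLM_castAdd, antidiagCLM_natAdd, Pi.smul_apply, Pi.sub_apply,
      single_castAdd_castAdd, single_castAdd_natAdd, single_natAdd_castAdd,
      single_natAdd_natAdd, smul_eq_mul] <;> ring

theorem phaseCLM_single_castAdd (t : Fin N → ℝ) (j : Fin N) :
    phaseCLM N t (Pi.single (Fin.castAdd N j) 1) = 0 := by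
  simp only [phaseCLM_apply, dotR, secondB, single_castAdd_natAdd, mul_zero,
    Finset.sum_const_zero]

theorem phaseCLM_single_natAdd (t : Fin N → ℝ) (j : Fin N) :
    phaseCLM N t (Pi.single (Fin.natAdd N j) 1) = t j := by
  simp only [phaseCLM_apply, dotR, secondB, single_natAdd_natAdd]
  simp [Pi.single_apply]

theorem phaseCLM_single_left (z : Fin (N + N) → ℝ) (j : Fin N) :
    phaseCLM N (Pi.single j 1) z = z (Fin.natAdd N j) := by
  simp [phaseCLM_apply, dotR, secondB, Pi.single_apply]

theorem mulC_castAdd_Wig {f : (Fin (N + N) → ℝ) → ℂ} (j : Fin N) :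
    mulC (Fin.castAdd N j) (Wig f) =
      Wig ((((1 : ℂ) / 2) • (mulC (Fin.natAdd N j) + mulC (Fin.castAdd N j)) : OpC (N + N)) f) := by
  funext z
  rw [mulC, Wig_apply, Wig_apply, ← integral_const_mul]
  congr 1
  funext t
  simp [mulC, -Fin.natAdd_eq_addNat]
  ring

theorem Dc_castAdd_Wig {f : (Fin (N + N) → ℝ) → ℂ} (hf : IsSchwartz f) (j : Fin N) :
    Dc (Fin.castAdd N j) (Wig f) =
      Wig ((Dc (Fin.castAdd N j) + Dc (Fin.natAdd N j) : OpC (N + N)) f) := by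
  obtain ⟨s, rfl⟩ := hf
  funext z
  rw [Dc, pD_Wig, Wig_apply, ← integral_const_mul]
  congr 1
  funext t
  simp only [diagCLM_single_castAdd, phaseCLM_single_castAdd, map_add, Pi.add_apply, Dc, pD]
  push_cast
  ring

theorem Dc_natAdd_Wig {f : (Fin (N + N) → ℝ) → ℂ} (hf : IsSchwartz f) (j : Fin N) :
    Dc (Fin.natAdd N j) (Wig f) =
      Wig ((mulC (Fin.natAdd N j) - mulC (Fin.castAdd N j) : OpC (N + N)) f) := by
  obtain ⟨s, rfl⟩ := hf
  funext z
  rw [Dc, pD_Wig, Wig_apply, ← integral_const_mul]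
  congr 1
  funext t
  simp only [diagCLM_single_natAdd, phaseCLM_single_natAdd, map_zero, Pi.sub_apply, mulC,
    Pi.add_apply, diagCLM_natAdd, diagCLM_castAdd, antidiagCLM_natAdd, antidiagCLM_castAdd]
  push_cast
  linear_combination (osc z t * t j * s (diagCLM N z + antidiagCLM N t)) * Complex.I_mul_I

theorem mulC_natAdd_Wig {f : (Fin (N + N) → ℝ) → ℂ} (hf : IsSchwartz f) (j : Fin N) :
    mulC (Fin.natAdd N j) (Wig f) =
      Wig ((((1 : ℂ) / 2) • (Dc (Fin.castAdd N j) - Dc (Fin.natAdd N j)) : OpC (N + N)) f) := by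
  funext z
  have hint := integrable_osc_mul hf z
  have hint₁ := integrable_osc_mul (hf.pD (Fin.castAdd N j)) z
  have hint₂ := integrable_osc_mul (hf.pD (Fin.natAdd N j)) z
  obtain ⟨s, rfl⟩ := hf
  have hg : ∀ t, HasFDerivAt (fun t => s (diagCLM N z + antidiagCLM N t))
      ((fderiv ℝ s (diagCLM N z + antidiagCLM N t)).comp (antidiagCLM N)) t := fun t =>
    (s.hasFDerivAt _).comp t ((antidiagCLM N).hasFDerivAt.const_add _)
  have hosc' : ∀ t, fderiv ℝ (osc z) t (Pi.single j 1) =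
      -(Complex.I * z (Fin.natAdd N j)) * osc z t := by
    intro t
    rw [(hasFDerivAt_osc_right z t).fderiv]
    simp [phaseCLM_single_left]
    ring
  have hg' : ∀ t, fderiv ℝ (fun t => s (diagCLM N z + antidiagCLM N t)) t (Pi.single j 1) =
      2⁻¹ * (pD (Fin.castAdd N j) s (diagCLM N z + antidiagCLM N t) -
        pD (Fin.natAdd N j) s (diagCLM N z + antidiagCLM N t)) := by
    intro t
    rw [(hg t).fderiv, ContinuousLinearMap.comp_apply, antidiagCLM_single, map_smul, map_sub]
    simp [pD]
  have key := integral_mul_fderiv_eq_neg_fderiv_mul_of_integrable (μ := volume) (f := osc z)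
    (g := fun t => s (diagCLM N z + antidiagCLM N t)) (v := Pi.single j 1)
    (by
      simp only [hosc', mul_assoc]
      exact hint.const_mul _)
    (by
      simp only [hg']
      refine ((hint₁.sub hint₂).const_mul 2⁻¹).congr (Eventually.of_forall fun t => ?_)
      simp only [Pi.sub_apply]
      ring)
    hint (fun t _ => (hasFDerivAt_osc_right z t).differentiableAt)
    (fun t _ => (hg t).differentiableAt)
  simp only [hosc', hg', mul_assoc, integral_const_mul] at key
  have hW : Wig ((((1 : ℂ) / 2) • (Dc (Fin.castAdd N j) - Dc (Fin.natAdd N j)) :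
      OpC (N + N)) ⇑s) z = -Complex.I * ∫ t, osc z t *
        (2⁻¹ * (pD (Fin.castAdd N j) s (diagCLM N z + antidiagCLM N t) -
          pD (Fin.natAdd N j) s (diagCLM N z + antidiagCLM N t))) := by
    rw [Wig_apply, ← integral_const_mul]
    congr 1
    funext t
    simp [Dc]
    ring
  rw [hW, key, mulC, Wig_apply]
  linear_combination ((z (Fin.natAdd N j) : ℂ) *
    ∫ t, osc z t * s (diagCLM N z + antidiagCLM N t)) * Complex.I_mul_I

theorem Wig_sum_smul {ι : Type*} (F : Finset ι) (c : ι → ℂ)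
    (f : ι → (Fin (N + N) → ℝ) → ℂ) (hf : ∀ q ∈ F, IsSchwartz (f q)) :
    Wig (∑ q ∈ F, c q • f q) = ∑ q ∈ F, c q • Wig (f q) := by
  funext z
  simp only [Wig_apply, Finset.sum_apply, Pi.smul_apply, smul_eq_mul, Finset.mul_sum]
  rw [integral_finsetSum]
  · refine Finset.sum_congr rfl fun q _ => ?_
    rw [← integral_const_mul]
    congr 1
    funext t
    ring
  · intro q hq
    refine ((integrable_osc_mul (hf q hq) z).const_mul (c q)).congr
      (Eventually.of_forall fun t => ?_)
    simp only
    ring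

end Wigner

/-- For a partial differential operator `P` with polynomial coefficients,
`P(M_f,M_s,D_f,D_s) Wig[u] = Wig[ P̄ u ]` with
`P̄ = Σ c ((M_s+M_f)/2)^α ((D_f-D_s)/2)^β (D_f+D_s)^γ (M_s-M_f)^μ`
(Proposition 4.6 of the paper). -/
theorem statement_14 (N m : ℕ)
    (F : Finset ((Fin N → ℕ) × (Fin N → ℕ) × (Fin N → ℕ) × (Fin N → ℕ)))
    (c : ((Fin N → ℕ) × (Fin N → ℕ) × (Fin N → ℕ) × (Fin N → ℕ)) → ℂ)
    (hdeg : ∀ q ∈ F, (∑ j, (q.1 j + q.2.1 j + q.2.2.1 j + q.2.2.2 j)) ≤ m)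
    (u : SchwartzMap ((Fin (N + N) → ℝ)) ℂ) :
    (∑ q ∈ F, c q • (fun z : Fin (N + N) → ℝ =>
        ((∏ j, (firstB z j) ^ (q.1 j) : ℝ) : ℂ) *
          (((∏ j, (secondB z j) ^ (q.2.1 j) : ℝ) : ℂ) *
            Dpow (Fin.append q.2.2.1 q.2.2.2) (Wig (⇑u)) z))) =
      Wig (∑ q ∈ F, c q •
        vecPow (fun j => ((1 : ℂ) / 2) • (mulC (Fin.natAdd N j) + mulC (Fin.castAdd N j))) q.1
          (vecPow (fun j => ((1 : ℂ) / 2) • (Dc (Fin.castAdd N j) - Dc (Fin.natAdd N j))) q.2.1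
            (vecPow (fun j => Dc (Fin.castAdd N j) + Dc (Fin.natAdd N j)) q.2.2.1
              (vecPow (fun j => mulC (Fin.natAdd N j) - mulC (Fin.castAdd N j)) q.2.2.2
                (⇑u))))) := by
  have hS (q : (Fin N → ℕ) × (Fin N → ℕ) × (Fin N → ℕ) × (Fin N → ℕ)) :=
    vecPow_intertwine (W := Wig) (A := fun j => Dc (Fin.natAdd N j))
      (B := fun j => mulC (Fin.natAdd N j) - mulC (Fin.castAdd N j))
      (fun j f hf => (hf.mulC (Fin.natAdd N j)).sub (hf.mulC (Fin.castAdd N j)))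
      (fun j f hf => Dc_natAdd_Wig hf j) q.2.2.2 ⟨u, rfl⟩
  have hγ (q : (Fin N → ℕ) × (Fin N → ℕ) × (Fin N → ℕ) × (Fin N → ℕ)) :=
    vecPow_intertwine (W := Wig) (A := fun j => Dc (Fin.castAdd N j))
      (B := fun j => Dc (Fin.castAdd N j) + Dc (Fin.natAdd N j))
      (fun j f hf => (hf.Dc (Fin.castAdd N j)).add (hf.Dc (Fin.natAdd N j)))
      (fun j f hf => Dc_castAdd_Wig hf j) q.2.2.1 (hS q).1
  have hβ (q : (Fin N → ℕ) × (Fin N → ℕ) × (Fin N → ℕ) × (Fin N → ℕ)) :=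
    vecPow_intertwine (W := Wig) (A := fun j => mulC (Fin.natAdd N j))
      (B := fun j => ((1 : ℂ) / 2) • (Dc (Fin.castAdd N j) - Dc (Fin.natAdd N j)))
      (fun j f hf => ((hf.Dc (Fin.castAdd N j)).sub (hf.Dc (Fin.natAdd N j))).smul _)
      (fun j f hf => mulC_natAdd_Wig hf j) q.2.1 (hγ q).1
  have hα (q : (Fin N → ℕ) × (Fin N → ℕ) × (Fin N → ℕ) × (Fin N → ℕ)) :=
    vecPow_intertwine (W := Wig) (A := fun j => mulC (Fin.castAdd N j))
      (B := fun j => ((1 : ℂ) / 2) • (mulC (Fin.natAdd N j) + mulC (Fin.castAdd N j)))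
      (fun j f hf => ((hf.mulC (Fin.natAdd N j)).add (hf.mulC (Fin.castAdd N j))).smul _)
      (fun j f hf => mulC_castAdd_Wig j) q.1 (hβ q).1
  rw [Wig_sum_smul _ _ _ fun q _ => (hα q).1]
  refine Finset.sum_congr rfl fun q _ => ?_
  rw [← (hα q).2, ← (hβ q).2, ← (hγ q).2, ← (hS q).2]
  congr 1
  funext z
  rw [vecPow_mulC, vecPow_mulC, Dpow_eq_vecPow, vecPow_append]
  rfl

end
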